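/- arXiv:2407.13728 — 2 statements merged into one kernel-verified Lean document; each statement's English description precedes it below -/
import Mathlib

section
/- For α ∈ (1,∞), a nonzero Hermitian operator γ and positive semidefinite operators σ, σ' on the same finite-dimensional Hilbert space, the extended sandwiched Rényi divergence is monotonically nonincreasing in its second argument: D̃_α(γ ∥ σ + σ') ≤ D̃_α(γ ∥ σ). -/
open scoped Kronecker
open Matrix Filter Topology
open scoped ComplexOrder
attribute [local instance] Classical.propDecidable

namespace QHE

/-- Functional calculus for Hermitian matrices (junk value `0` on non-Hermitian input). -/
noncomputable def mfun {n : Type*} [Fintype n] [DecidableEq n] (f : ℝ → ℝ)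
    (A : Matrix n n ℂ) : Matrix n n ℂ :=
  if hA : A.IsHermitian then
    (hA.eigenvectorUnitary : Matrix n n ℂ) *
      Matrix.diagonal (fun i => (f (hA.eigenvalues i) : ℂ)) *
      (star (hA.eigenvectorUnitary : Matrix n n ℂ))
  else 0

/-- Real power of a Hermitian matrix, taken on its support (`0 ^ r = 0`). -/
noncomputable def mpow {n : Type*} [Fintype n] [DecidableEq n] (A : Matrix n n ℂ) (r : ℝ) :
    Matrix n n ℂ :=
  mfun (fun x => if x = 0 then 0 else Real.rpow x r) A

/-- Logarithm of a Hermitian matrix, taken on its support. -/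
noncomputable def mlog {n : Type*} [Fintype n] [DecidableEq n] (A : Matrix n n ℂ) :
    Matrix n n ℂ :=
  mfun (fun x => if x = 0 then 0 else Real.log x) A

/-- `‖X‖_α ^ α = Tr[(Xᴴ X)^(α/2)]`, the α-th power of the Schatten α-norm. -/
noncomputable def schattenPow {n : Type*} [Fintype n] [DecidableEq n] (α : ℝ)
    (X : Matrix n n ℂ) : ℝ :=
  ((mpow (Xᴴ * X) (α / 2)).trace).re

/-- Support inclusion `supp γ ⊆ supp σ`, phrased as kernel inclusion `ker σ ⊆ ker γ`. -/
noncomputable def suppLE {n : Type*} [Fintype n] (γ σ : Matrix n n ℂ) : Prop :=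
  ∀ v : n → ℂ, σ.mulVec v = 0 → γ.mulVec v = 0

/-- Extended sandwiched Rényi quasi-divergence
`Q̃_α(γ∥σ) = ‖σ^((1-α)/(2α)) γ σ^((1-α)/(2α))‖_α^α`. -/
noncomputable def sandQ {n : Type*} [Fintype n] [DecidableEq n] (α : ℝ)
    (γ σ : Matrix n n ℂ) : ℝ :=
  schattenPow α (mpow σ ((1 - α) / (2 * α)) * γ * mpow σ ((1 - α) / (2 * α)))

/-- Extended sandwiched Rényi divergence (real-valued formula, meaningful when
`supp γ ⊆ supp σ`). -/
noncomputable def sandDR {n : Type*} [Fintype n] [DecidableEq n] (α : ℝ)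
    (γ σ : Matrix n n ℂ) : ℝ :=
  (1 / (α - 1)) * Real.log (sandQ α γ σ)

/-- Extended sandwiched Rényi divergence, `+∞` when the support condition fails. -/
noncomputable def sandD {n : Type*} [Fintype n] [DecidableEq n] (α : ℝ)
    (γ σ : Matrix n n ℂ) : EReal :=
  if suppLE γ σ then ((sandDR α γ σ : ℝ) : EReal) else ⊤

/-- Trace norm `‖X‖₁`. -/
noncomputable def traceNorm {n : Type*} [Fintype n] [DecidableEq n] (X : Matrix n n ℂ) : ℝ :=
  schattenPow 1 X

/-- Absolute value `|X| = (Xᴴ X)^(1/2)`. -/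
noncomputable def matAbs {n : Type*} [Fintype n] [DecidableEq n] (X : Matrix n n ℂ) :
    Matrix n n ℂ :=
  mpow (Xᴴ * X) (1 / 2 : ℝ)

/-- Umegaki relative entropy `Tr[ρ(ln ρ − ln σ)]` (real-valued formula). -/
noncomputable def umegakiR {n : Type*} [Fintype n] [DecidableEq n] (ρ σ : Matrix n n ℂ) : ℝ :=
  ((ρ * (mlog ρ - mlog σ)).trace).re

/-- Umegaki relative entropy, `+∞` when the support condition fails. -/
noncomputable def umegaki {n : Type*} [Fintype n] [DecidableEq n] (ρ σ : Matrix n n ℂ) : EReal :=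
  if suppLE ρ σ then ((umegakiR ρ σ : ℝ) : EReal) else ⊤

/-- Density operator: positive semidefinite with unit trace. -/
noncomputable def IsState {n : Type*} [Fintype n] (ρ : Matrix n n ℂ) : Prop :=
  ρ.PosSemidef ∧ ρ.trace = 1

/-- Unit-trace Hermitian operator. -/
def UnitTraceHerm {n : Type*} [Fintype n] (τ : Matrix n n ℂ) : Prop :=
  τ.IsHermitian ∧ τ.trace = 1

/-- `−ln x`, valued `+∞` for `x ≤ 0`. -/
noncomputable def negLogE (x : ℝ) : EReal :=
  if x ≤ 0 then ⊤ else ((-Real.log x : ℝ) : EReal)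

/-- Extended hypothesis-testing divergence
`D_H^ε(τ∥σ) = sup{−ln Tr[Λσ] : 0 ≤ Λ ≤ I, Tr[Λτ] ≥ 1−ε}`. -/
noncomputable def DH {n : Type*} [Fintype n] [DecidableEq n] (ε : ℝ)
    (τ σ : Matrix n n ℂ) : EReal :=
  ⨆ Λ ∈ {Λ : Matrix n n ℂ |
      Λ.PosSemidef ∧ (1 - Λ).PosSemidef ∧ 1 - ε ≤ ((Λ * τ).trace).re},
    negLogE (((Λ * σ).trace).re)

/-- Optimal error probability of state exclusion for the ensemble `(p, ρ)`. -/
noncomputable def Perr {n ι : Type*} [Fintype n] [DecidableEq n] [Fintype ι]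
    (p : ι → ℝ) (ρ : ι → Matrix n n ℂ) : ℝ :=
  sInf {e : ℝ | ∃ Λ : ι → Matrix n n ℂ, (∀ x, (Λ x).PosSemidef) ∧ (∑ x, Λ x = 1) ∧
    e = ∑ x, p x * (((Λ x) * (ρ x)).trace).re}

/-- Optimal success probability of state discrimination for the ensemble `(p, ρ)`. -/
noncomputable def Psucc {n ι : Type*} [Fintype n] [DecidableEq n] [Fintype ι]
    (p : ι → ℝ) (ρ : ι → Matrix n n ℂ) : ℝ :=
  sSup {e : ℝ | ∃ Λ : ι → Matrix n n ℂ, (∀ x, (Λ x).PosSemidef) ∧ (∑ x, Λ x = 1) ∧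
    e = ∑ x, p x * (((Λ x) * (ρ x)).trace).re}

/-- The probability simplex over a finite index type. -/
def probSimplex (ι : Type*) [Fintype ι] : Set (ι → ℝ) :=
  {s | (∀ x, 0 ≤ s x) ∧ ∑ x, s x = 1}

/-- CPTP maps, characterized by Kraus representations. -/
def IsCPTP {n m : Type*} [Fintype n] [DecidableEq n] [Fintype m] [DecidableEq m]
    (Φ : Matrix n n ℂ → Matrix m m ℂ) : Prop :=
  ∃ (k : ℕ) (K : Fin k → Matrix m n ℂ), (∑ i, (K i)ᴴ * K i = 1) ∧
    ∀ A, Φ A = ∑ i, K i * A * (K i)ᴴ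

/-- Completely positive maps, characterized by Kraus representations. -/
def IsCPMap {n m : Type*} [Fintype n] [DecidableEq n] [Fintype m] [DecidableEq m]
    (Φ : Matrix n n ℂ → Matrix m m ℂ) : Prop :=
  ∃ (k : ℕ) (K : Fin k → Matrix m n ℂ), ∀ A, Φ A = ∑ i, K i * A * (K i)ᴴ

/-- Extension `id_{C^d} ⊗ Φ` of a (linear) map `Φ` to a `d`-dimensional reference system. -/
noncomputable def matExt {n m : Type*} (Φ : Matrix n n ℂ → Matrix m m ℂ) (d : ℕ)
    (X : Matrix (Fin d × n) (Fin d × n) ℂ) : Matrix (Fin d × m) (Fin d × m) ℂ :=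
  Matrix.of fun p q => Φ (Matrix.of fun a b => X (p.1, a) (q.1, b)) p.2 q.2

/-- Partial trace over the first tensor factor. -/
noncomputable def ptraceFst {a b : Type*} [Fintype a] (X : Matrix (a × b) (a × b) ℂ) : Matrix b b ℂ :=
  Matrix.of fun i j => ∑ k : a, X (k, i) (k, j)

/-- `k`-fold tensor power `A^{⊗k}` of a matrix. -/
noncomputable def tensPow {n : Type*} [Fintype n] (A : Matrix n n ℂ) (k : ℕ) :
    Matrix (Fin k → n) (Fin k → n) ℂ :=
  Matrix.of fun f g => ∏ i, A (f i) (g i)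

/-- Max-divergence `D_max(ρ∥σ) = inf{ln λ : λ ≥ 0, ρ ≤ λσ}` (`+∞` if infeasible). -/
noncomputable def Dmax {n : Type*} [Fintype n] [DecidableEq n] (ρ σ : Matrix n n ℂ) : EReal :=
  ⨅ l ∈ {l : ℝ | 0 ≤ l ∧ (l • σ - ρ).PosSemidef}, ((Real.log l : ℝ) : EReal)

/-- Channel divergence induced by a family of state divergences `D`:
supremum over reference dimensions and bipartite input states. -/
noncomputable def Dch
    (D : (k : Type) → [Fintype k] → [DecidableEq k] → Matrix k k ℂ → Matrix k k ℂ → EReal)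
    {n m : Type} [Fintype n] [DecidableEq n] [Fintype m] [DecidableEq m]
    (N M : Matrix n n ℂ → Matrix m m ℂ) : EReal :=
  ⨆ (d : ℕ), ⨆ ρ ∈ {ρ : Matrix (Fin d × n) (Fin d × n) ℂ | IsState ρ},
    D (Fin d × m) (matExt N d ρ) (matExt M d ρ)


section

open scoped MatrixOrder Matrix.Norms.L2Operator

variable {n : Type*} [Fintype n] [DecidableEq n] {A K M γ σ τ : Matrix n n ℂ}

lemma continuousOn_spectrum (f : ℝ → ℝ) (A : Matrix n n ℂ) : ContinuousOn f (spectrum ℝ A) :=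
  A.finite_real_spectrum.continuousOn f

lemma mfun_eq_cfc (hA : A.IsHermitian) (f : ℝ → ℝ) : mfun f A = cfc f A := by
  rw [hA.cfc_eq, mfun, dif_pos hA, Matrix.IsHermitian.cfc, Unitary.conjStarAlgAut_apply]
  rfl

lemma mfun_isHermitian (f : ℝ → ℝ) (A : Matrix n n ℂ) : (mfun f A).IsHermitian := by
  by_cases hA : A.IsHermitian
  · rw [mfun_eq_cfc hA]
    exact cfc_predicate f A
  · rw [mfun, dif_neg hA]
    exact isHermitian_zero

lemma trace_mfun (hA : A.IsHermitian) (f : ℝ → ℝ) :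
    (mfun f A).trace = ∑ i, (f (hA.eigenvalues i) : ℂ) := by
  rw [mfun, dif_pos hA, trace_mul_comm, ← mul_assoc, Unitary.coe_star_mul_self, one_mul,
    trace_diagonal]

/-- For Hermitian `A`, `‖A‖_α ^ α` is the sum of the `|λ| ^ α` over the eigenvalues `λ`. -/
lemma schattenPow_eq_sum (hA : A.IsHermitian) {α : ℝ} (hα : 0 < α) :
    schattenPow α A = ∑ i, |hA.eigenvalues i| ^ α := by
  have hsa : IsSelfAdjoint A := hA
  have hsq : (Aᴴ * A).IsHermitian := isHermitian_conjTranspose_mul_self A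
  have h1 : Aᴴ * A = cfc (fun x : ℝ => x ^ 2) A := by
    rw [hA.eq, cfc_pow_id A 2, sq]
  rw [schattenPow, mpow, mfun_eq_cfc hsq, h1, ← cfc_comp' _ _ A
    (A.finite_real_spectrum.image _ |>.continuousOn _) (continuousOn_spectrum _ _),
    ← mfun_eq_cfc hA, trace_mfun hA, Complex.re_sum]
  refine Finset.sum_congr rfl fun i _ => ?_
  rw [Complex.ofReal_re]
  rcases eq_or_ne (hA.eigenvalues i) 0 with h | h
  · simp [h, Real.zero_rpow hα.ne']
  · rw [if_neg (pow_ne_zero 2 h), ← sq_abs]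
    change (|hA.eigenvalues i| ^ 2) ^ (α / 2) = _
    rw [← Real.rpow_natCast, ← Real.rpow_mul (abs_nonneg _)]
    congr 1
    push_cast
    ring

lemma schattenPow_pos (hA : A.IsHermitian) (hA0 : A ≠ 0) {α : ℝ} (hα : 0 < α) :
    0 < schattenPow α A := by
  rw [schattenPow_eq_sum hA hα]
  obtain ⟨i, hi⟩ := Function.ne_iff.mp (mt hA.eigenvalues_eq_zero_iff.mp hA0)
  exact Finset.sum_pos' (fun j _ => by positivity)
    ⟨i, Finset.mem_univ i, Real.rpow_pos_of_pos (abs_pos.mpr hi) α⟩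

lemma norm_le_one_of_mul_conjTranspose_le_one (hK : K * Kᴴ ≤ 1) : ‖K‖ ≤ 1 := by
  have h := (CStarAlgebra.norm_le_one_iff_of_nonneg (K * star K) (mul_star_self_nonneg K)).mpr hK
  rw [CStarRing.norm_self_mul_star] at h
  nlinarith [norm_nonneg K]

lemma sum_sq_norm_row_le_one (hM : ‖M‖ ≤ 1) (i : n) : ∑ j, ‖M i j‖ ^ 2 ≤ 1 := by
  have h : M * star M ≤ 1 := by
    rw [← CStarAlgebra.norm_le_one_iff_of_nonneg _ (mul_star_self_nonneg M),
      CStarRing.norm_self_mul_star]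
    nlinarith [norm_nonneg M]
  have h1 := (Matrix.le_iff.mp h).diag_nonneg (i := i)
  have h2 : (1 - M * star M) i i = ((1 - ∑ j, ‖M i j‖ ^ 2 : ℝ) : ℂ) := by
    simp [Matrix.mul_apply, Complex.mul_conj, Complex.normSq_eq_norm_sq]
  rw [h2, Complex.zero_le_real] at h1
  linarith

lemma sum_sq_norm_col_le_one (hM : ‖M‖ ≤ 1) (j : n) : ∑ i, ‖M i j‖ ^ 2 ≤ 1 := by
  have h := sum_sq_norm_row_le_one (M := Mᴴ) (by rwa [l2_opNorm_conjTranspose]) j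
  simpa using h

/-- Convexity of `t ↦ t ^ α` transported along a substochastic matrix. -/
lemma sum_rpow_le_of_substochastic {ι : Type*} [Fintype ι] {α : ℝ} (hα : 1 < α)
    {w : ι → ι → ℝ} (hw : ∀ i j, 0 ≤ w i j) (hrow : ∀ i, ∑ j, w i j ≤ 1)
    (hcol : ∀ j, ∑ i, w i j ≤ 1) {a b : ι → ℝ} (hb : ∀ i, 0 ≤ b i) (ha : ∀ j, 0 ≤ a j)
    (hba : ∀ i, b i ≤ ∑ j, w i j * a j) :
    ∑ i, b i ^ α ≤ ∑ j, a j ^ α := by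
  have hα0 : 0 < α := by linarith
  have key : ∀ i, b i ^ α ≤ ∑ j, w i j * a j ^ α := fun i => by
    have hsum : 0 ≤ ∑ j, w i j * a j ^ α :=
      Finset.sum_nonneg fun j _ => mul_nonneg (hw i j) (Real.rpow_nonneg (ha j) α)
    have h1 : b i ≤ (∑ j, w i j * a j ^ α) ^ α⁻¹ :=
      calc b i ≤ ∑ j, w i j * a j := hba i
        _ ≤ (∑ j, w i j) ^ (1 - α⁻¹) * (∑ j, w i j * a j ^ α) ^ α⁻¹ :=
          Real.inner_le_weight_mul_Lp_of_nonneg _ hα.le _ _ (hw i) ha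
        _ ≤ _ := mul_le_of_le_one_left (Real.rpow_nonneg hsum _)
          (Real.rpow_le_one (Finset.sum_nonneg fun j _ => hw i j) (hrow i)
            (sub_nonneg.mpr (inv_le_one_of_one_le₀ hα.le)))
    calc b i ^ α ≤ ((∑ j, w i j * a j ^ α) ^ α⁻¹) ^ α :=
          Real.rpow_le_rpow (hb i) h1 hα0.le
      _ = _ := Real.rpow_inv_rpow hsum hα0.ne'
  calc ∑ i, b i ^ α ≤ ∑ i, ∑ j, w i j * a j ^ α := Finset.sum_le_sum fun i _ => key i
    _ = ∑ j, (∑ i, w i j) * a j ^ α := by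
      rw [Finset.sum_comm]
      simp_rw [Finset.sum_mul]
    _ ≤ ∑ j, a j ^ α := Finset.sum_le_sum fun j _ =>
      mul_le_of_le_one_left (Real.rpow_nonneg (ha j) α) (hcol j)

/-- Conjugation by a contraction does not increase the Schatten norm of a Hermitian matrix. -/
lemma schattenPow_conj_le (hA : A.IsHermitian) (hK : ‖K‖ ≤ 1) {α : ℝ} (hα : 1 < α) :
    schattenPow α (K * A * Kᴴ) ≤ schattenPow α A := by
  have hB : (K * A * Kᴴ).IsHermitian := isHermitian_mul_mul_conjTranspose K hA
  have hα0 : 0 < α := by linarith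
  rw [schattenPow_eq_sum hB hα0, schattenPow_eq_sum hA hα0]
  set U := hB.eigenvectorUnitary
  set V := hA.eigenvectorUnitary
  set M : Matrix n n ℂ := (star U : Matrix n n ℂ) * K * (V : Matrix n n ℂ) with hMdef
  have hM : ‖M‖ ≤ 1 := by
    rw [hMdef, CStarRing.norm_mul_coe_unitary, ← Unitary.coe_star, CStarRing.norm_coe_unitary_mul]
    exact hK
  have hdiag : diagonal (fun i => (hB.eigenvalues i : ℂ)) =
      M * diagonal (fun i => (hA.eigenvalues i : ℂ)) * Mᴴ := by
    have h1 : K * A * Kᴴ =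
        U * diagonal (fun i => (hB.eigenvalues i : ℂ)) * (star U : Matrix n n ℂ) := by
      have := hB.spectral_theorem
      rwa [Unitary.conjStarAlgAut_apply] at this
    have h2 : A = V * diagonal (fun i => (hA.eigenvalues i : ℂ)) * (star V : Matrix n n ℂ) := by
      have := hA.spectral_theorem
      rwa [Unitary.conjStarAlgAut_apply] at this
    have h3 : (star U : Matrix n n ℂ) * (K * A * Kᴴ) * U =
        diagonal (fun i => (hB.eigenvalues i : ℂ)) := by
      refine (congr_arg (fun X => (star U : Matrix n n ℂ) * X * U) h1).trans ?_
      simp only [mul_assoc, Unitary.coe_star_mul_self, mul_one]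
      rw [← mul_assoc, Unitary.coe_star_mul_self, one_mul]
    rw [← h3]
    conv_lhs => rw [h2]
    simp only [hMdef, conjTranspose_mul, star_eq_conjTranspose, conjTranspose_conjTranspose,
      mul_assoc]
  refine sum_rpow_le_of_substochastic hα (w := fun i j => ‖M i j‖ ^ 2) (fun i j => by positivity)
    (sum_sq_norm_row_le_one hM) (sum_sq_norm_col_le_one hM) (fun i => abs_nonneg _)
    (fun j => abs_nonneg _) fun i => ?_
  have hi : hB.eigenvalues i = ∑ j, ‖M i j‖ ^ 2 * hA.eigenvalues j := by
    have h := congr_fun (congr_fun hdiag i) i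
    rw [diagonal_apply_eq, Matrix.mul_apply] at h
    apply Complex.ofReal_injective
    rw [h]
    push_cast
    refine Finset.sum_congr rfl fun j _ => ?_
    rw [mul_diagonal, conjTranspose_apply, mul_right_comm, Complex.star_def, Complex.mul_conj,
      Complex.normSq_eq_norm_sq]
    push_cast
    rfl
  rw [hi]
  refine (Finset.abs_sum_le_sum_abs _ _).trans_eq (Finset.sum_congr rfl fun j _ => ?_)
  rw [abs_mul, abs_of_nonneg (by positivity)]

/-- The orthogonal projection onto the support of a Hermitian matrix. -/
noncomputable def suppProj (A : Matrix n n ℂ) : Matrix n n ℂ :=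
  mfun (fun x => if x = 0 then 0 else 1) A

lemma suppProj_isHermitian (A : Matrix n n ℂ) : (suppProj A).IsHermitian :=
  mfun_isHermitian _ A

lemma mul_suppProj (hA : A.IsHermitian) : A * suppProj A = A := by
  have hsa : IsSelfAdjoint A := hA
  rw [suppProj, mfun_eq_cfc hA]
  conv_lhs => enter [1]; rw [← cfc_id' ℝ A]
  rw [← cfc_mul _ _ A (continuousOn_spectrum _ _) (continuousOn_spectrum _ _)]
  conv_rhs => rw [← cfc_id' ℝ A]
  congr 1
  ext x
  by_cases h : x = 0 <;> simp [h]

lemma suppProj_le_one (hA : A.IsHermitian) : suppProj A ≤ 1 := by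
  rw [suppProj, mfun_eq_cfc hA]
  exact cfc_le_one _ _ fun x _ => by split_ifs <;> norm_num

lemma mul_suppProj_of_suppLE (hσ : σ.IsHermitian) (h : suppLE γ σ) : γ * suppProj σ = γ := by
  have h0 : σ * (1 - suppProj σ) = 0 := by rw [mul_sub, mul_one, mul_suppProj hσ, sub_self]
  have h1 : γ * (1 - suppProj σ) = 0 := by
    ext i j
    have := congr_fun (h ((1 - suppProj σ).col j) (by
      ext k; exact congr_fun (congr_fun h0 k) j)) i
    exact this
  rw [mul_sub, mul_one, sub_eq_zero] at h1
  exact h1.symm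

lemma suppProj_mul_of_suppLE (hσ : σ.IsHermitian) (hγ : γ.IsHermitian) (h : suppLE γ σ) :
    suppProj σ * γ = γ := by
  have := congr_arg conjTranspose (mul_suppProj_of_suppLE hσ h)
  rwa [conjTranspose_mul, hγ.eq, (suppProj_isHermitian σ).eq] at this

lemma mpow_mul_mpow (hA : A.PosSemidef) (r s : ℝ) : mpow A r * mpow A s =
    mfun (fun x => if x = 0 then 0 else x ^ (r + s)) A := by
  have hA' := hA.isHermitian
  rw [mpow, mpow, mfun_eq_cfc hA', mfun_eq_cfc hA', mfun_eq_cfc hA',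
    ← cfc_mul _ _ A (continuousOn_spectrum _ _) (continuousOn_spectrum _ _)]
  refine cfc_congr fun x hx => ?_
  have hx0 : 0 ≤ x := spectrum_nonneg_of_nonneg hA.nonneg hx
  rcases eq_or_ne x 0 with h | h
  · simp [h]
  · simp only [if_neg h]
    exact (Real.rpow_add (lt_of_le_of_ne hx0 h.symm) r s).symm

lemma mpow_mul_mpow_neg (hA : A.PosSemidef) (r : ℝ) : mpow A r * mpow A (-r) = suppProj A := by
  rw [mpow_mul_mpow hA, suppProj]
  simp

lemma mpow_neg_mul_mpow (hA : A.PosSemidef) (r : ℝ) : mpow A (-r) * mpow A r = suppProj A := by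
  rw [mpow_mul_mpow hA, suppProj]
  simp

lemma mpow_mul_mpow_self (hA : A.PosSemidef) {r : ℝ} (hr : 0 < r) :
    mpow A r * mpow A r = A ^ (2 * r) := by
  rw [mpow_mul_mpow hA, mfun_eq_cfc hA.isHermitian, CFC.rpow_eq_cfc_real hA.nonneg]
  congr 1
  ext x
  rcases eq_or_ne x 0 with h | h
  · simp [h, Real.zero_rpow, hr.ne']
  · rw [if_neg h, two_mul]

lemma mpow_isHermitian (A : Matrix n n ℂ) (r : ℝ) : (mpow A r).IsHermitian :=
  mfun_isHermitian _ A

/-- Löwner–Heinz in contraction form: `τ ^ (-s) σ ^ s` is a contraction for `0 ≤ σ ≤ τ`. -/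
lemma norm_mpow_neg_mul_mpow_le_one (hσ : σ.PosSemidef) (hτ : τ.PosSemidef) (h : σ ≤ τ) {s : ℝ}
    (hs : 0 < s) (hs1 : 2 * s ≤ 1) : ‖mpow τ (-s) * mpow σ s‖ ≤ 1 := by
  apply norm_le_one_of_mul_conjTranspose_le_one
  have hle : σ ^ (2 * s) ≤ τ ^ (2 * s) := CFC.rpow_le_rpow ⟨by positivity, hs1⟩ h
  have hP : suppProj τ * suppProj τ = suppProj τ := by
    rw [suppProj, mfun_eq_cfc hτ.isHermitian,
      ← cfc_mul _ _ τ (continuousOn_spectrum _ _) (continuousOn_spectrum _ _)]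
    congr 1
    ext x
    split_ifs <;> simp
  calc mpow τ (-s) * mpow σ s * (mpow τ (-s) * mpow σ s)ᴴ
      = mpow τ (-s) * σ ^ (2 * s) * star (mpow τ (-s)) := by
        rw [← mpow_mul_mpow_self hσ hs, conjTranspose_mul, (mpow_isHermitian σ s).eq,
          star_eq_conjTranspose]
        simp only [mul_assoc]
    _ ≤ mpow τ (-s) * τ ^ (2 * s) * star (mpow τ (-s)) :=
        star_right_conjugate_le_conjugate hle _
    _ = suppProj τ := by
        rw [← mpow_mul_mpow_self hτ hs, star_eq_conjTranspose, (mpow_isHermitian τ (-s)).eq,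
          ← mul_assoc, mpow_neg_mul_mpow hτ, mul_assoc, mpow_mul_mpow_neg hτ, hP]
    _ ≤ 1 := suppProj_le_one hτ.isHermitian

lemma mpow_mul_sandwich_mul_mpow (hσ : σ.PosSemidef) (hγ : γ.IsHermitian) (h : suppLE γ σ)
    (s : ℝ) : mpow σ s * (mpow σ (-s) * γ * mpow σ (-s)) * mpow σ s = γ := by
  calc mpow σ s * (mpow σ (-s) * γ * mpow σ (-s)) * mpow σ s
      = (mpow σ s * mpow σ (-s)) * γ * (mpow σ (-s) * mpow σ s) := by simp only [mul_assoc]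
    _ = γ := by
      rw [mpow_mul_mpow_neg hσ, mpow_neg_mul_mpow hσ, suppProj_mul_of_suppLE hσ.isHermitian hγ h,
        mul_suppProj_of_suppLE hσ.isHermitian h]

lemma sandwich_isHermitian (hγ : γ.IsHermitian) (σ : Matrix n n ℂ) (r : ℝ) :
    (mpow σ r * γ * mpow σ r).IsHermitian := by
  have := isHermitian_mul_mul_conjTranspose (mpow σ r) hγ
  rwa [(mpow_isHermitian σ r).eq] at this

lemma sandQ_pos (hσ : σ.PosSemidef) (hγ : γ.IsHermitian) (hγ0 : γ ≠ 0) (h : suppLE γ σ) {α : ℝ}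
    (hα : 0 < α) : 0 < sandQ α γ σ := by
  refine schattenPow_pos (sandwich_isHermitian hγ σ _) (fun h0 => hγ0 ?_) hα
  rw [← mpow_mul_sandwich_mul_mpow hσ hγ h (-((1 - α) / (2 * α))), neg_neg, h0]
  simp

lemma sandQ_antitone (hσ : σ.PosSemidef) (hτ : τ.PosSemidef) (hστ : σ ≤ τ) (hγ : γ.IsHermitian)
    (h : suppLE γ σ) {α : ℝ} (hα : 1 < α) : sandQ α γ τ ≤ sandQ α γ σ := by
  obtain ⟨s, hs⟩ : ∃ s, s = (α - 1) / (2 * α) := ⟨_, rfl⟩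
  have hr : (1 - α) / (2 * α) = -s := by rw [hs, ← neg_div, neg_sub]
  have hs0 : 0 < s := by rw [hs]; exact div_pos (by linarith) (by linarith)
  have hs1 : 2 * s ≤ 1 := by
    rw [hs, ← mul_div_assoc, div_le_one (by linarith)]
    linarith
  rw [sandQ, sandQ, hr]
  have hconj : mpow τ (-s) * γ * mpow τ (-s) = (mpow τ (-s) * mpow σ s) *
      (mpow σ (-s) * γ * mpow σ (-s)) * (mpow τ (-s) * mpow σ s)ᴴ := by
    conv_lhs => rw [← mpow_mul_sandwich_mul_mpow hσ hγ h s]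
    rw [conjTranspose_mul, (mpow_isHermitian τ (-s)).eq, (mpow_isHermitian σ s).eq]
    simp only [mul_assoc]
  rw [hconj]
  exact schattenPow_conj_le (sandwich_isHermitian hγ σ _)
    (norm_mpow_neg_mul_mpow_le_one hσ hτ hστ hs0 hs1) hα

end

lemma suppLE_add {n : Type*} [Fintype n] {γ σ σ' : Matrix n n ℂ} (hσ : σ.PosSemidef)
    (hσ' : σ'.PosSemidef) (h : suppLE γ σ) : suppLE γ (σ + σ') := fun v hv => h v <| by
  have h0 : star v ⬝ᵥ σ.mulVec v + star v ⬝ᵥ σ'.mulVec v = 0 := by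
    rw [← dotProduct_add, ← add_mulVec, hv, dotProduct_zero]
  exact (hσ.dotProduct_mulVec_zero_iff v).mp ((add_eq_zero_iff_of_nonneg
    (hσ.dotProduct_mulVec_nonneg v) (hσ'.dotProduct_mulVec_nonneg v)).mp h0).1

/-- the extended sandwiched Rényi divergence is monotonically
nonincreasing in its second argument. -/
theorem extended_sandwiched_renyi_antitone_second
    {n : Type} [Fintype n] [DecidableEq n]
    (α : ℝ) (hα : 1 < α)
    (γ : Matrix n n ℂ) (hγ : γ.IsHermitian) (hγ0 : γ ≠ 0)
    (σ σ' : Matrix n n ℂ) (hσ : σ.PosSemidef) (hσ' : σ'.PosSemidef) :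
    sandD α γ (σ + σ') ≤ sandD α γ σ := by
  by_cases h : suppLE γ σ
  · have hτ := hσ.add hσ'
    have hsupp := suppLE_add hσ hσ' h
    have hle : sandQ α γ (σ + σ') ≤ sandQ α γ σ :=
      sandQ_antitone hσ hτ (Matrix.le_iff.mpr (by rwa [add_sub_cancel_left])) hγ h hα
    rw [sandD, sandD, if_pos hsupp, if_pos h, EReal.coe_le_coe_iff]
    exact mul_le_mul_of_nonneg_left
      (Real.log_le_log (sandQ_pos hτ hγ hγ0 hsupp (by linarith)) hle)
      (one_div_nonneg.mpr (by linarith))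
  · rw [sandD, sandD, if_neg h]
    exact le_top

end QHE
end

section
/- Let ρ_1,...,ρ_r be density operators on a finite-dimensional Hilbert space. Then the multivariate log-Euclidean Chernoff divergence is upper bounded by the negative logarithm of the SDP value κ: C♭(ρ_{[r]}) ≤ −ln κ(ρ_{[r]}), where κ(ρ_{[r]}) := sup{ Tr[γ] : γ Hermitian, −ρ_x ≤ γ ≤ ρ_x for all x }. -/
open scoped Kronecker
open Matrix Filter Topology
open scoped ComplexOrder
attribute [local instance] Classical.propDecidable

namespace QHE

section LogEntropy

open scoped Matrix.Norms.L2Operator MatrixOrder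

variable {n : Type*} [Fintype n] [DecidableEq n]

/-- Complex powers `exp (z • L)` of `exp L`, where `L = W * diagonal l * Wᴴ`. -/
noncomputable def conjExp (W : Matrix n n ℂ) (l : n → ℝ) (z : ℂ) : Matrix n n ℂ :=
  W * diagonal (fun a => Complex.exp (z * l a)) * Wᴴ

lemma conjExp_apply (W : Matrix n n ℂ) (l : n → ℝ) (z : ℂ) (i j : n) :
    conjExp W l z i j = ∑ a, W i a * Complex.exp (z * l a) * star (W j a) := by
  simp [conjExp, Matrix.mul_apply, Matrix.diagonal_apply]

lemma conjExp_zero {W : Matrix n n ℂ} (hW : W * Wᴴ = 1) (l : n → ℝ) :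
    conjExp W l 0 = 1 := by
  simp [conjExp, hW]

lemma conjExp_add {W : Matrix n n ℂ} (hW : Wᴴ * W = 1) (l : n → ℝ) (z w : ℂ) :
    conjExp W l (z + w) = conjExp W l z * conjExp W l w := by
  have : conjExp W l z * conjExp W l w =
      W * (diagonal (fun a => Complex.exp (z * l a)) * ((Wᴴ * W) *
        diagonal (fun a => Complex.exp (w * l a)))) * Wᴴ := by
    simp only [conjExp, Matrix.mul_assoc]
  rw [this, hW, Matrix.one_mul, Matrix.diagonal_mul_diagonal]
  simp [conjExp, add_mul, Complex.exp_add]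

lemma conjTranspose_conjExp (W : Matrix n n ℂ) (l : n → ℝ) (z : ℂ) :
    (conjExp W l z)ᴴ = conjExp W l (star z) := by
  simp only [conjExp, conjTranspose_mul, conjTranspose_conjTranspose, diagonal_conjTranspose,
    Matrix.mul_assoc]
  congr 3
  ext a
  simp [← Complex.exp_conj]

lemma norm_le_one_of_mul_conjTranspose {W : Matrix n n ℂ} (hW : W * Wᴴ = 1) : ‖W‖ ≤ 1 := by
  have h := CStarRing.norm_self_mul_star (x := W)
  rw [star_eq_conjTranspose, hW] at h
  have h1 : ‖(1 : Matrix n n ℂ)‖ ≤ 1 := by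
    rw [← diagonal_one, l2_opNorm_diagonal]
    exact (pi_norm_le_iff_of_nonneg zero_le_one).2 fun _ => by simp
  nlinarith [norm_nonneg W]

lemma norm_conjExp_le_one {W : Matrix n n ℂ} (hW : W * Wᴴ = 1) (l : n → ℝ) {z : ℂ}
    (hz : z.re = 0) : ‖conjExp W l z‖ ≤ 1 := by
  have hd : ‖diagonal (fun a => Complex.exp (z * l a))‖ ≤ 1 := by
    rw [l2_opNorm_diagonal]
    exact (pi_norm_le_iff_of_nonneg zero_le_one).2 fun a => by simp [Complex.norm_exp, hz]
  have hW1 := norm_le_one_of_mul_conjTranspose hW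
  calc ‖conjExp W l z‖ ≤ ‖W‖ * ‖diagonal (fun a => Complex.exp (z * l a))‖ * ‖Wᴴ‖ :=
        (norm_mul_le _ _).trans (by gcongr; exact norm_mul_le _ _)
    _ ≤ 1 * 1 * 1 := by
        rw [l2_opNorm_conjTranspose]; gcongr
    _ = 1 := by norm_num

lemma norm_apply_le_l2_opNorm (A : Matrix n n ℂ) (i j : n) : ‖A i j‖ ≤ ‖A‖ := by
  have h := l2_opNorm_mulVec A (EuclideanSpace.single j (1 : ℂ))
  refine le_trans ?_ (h.trans (by simp))
  refine le_trans ?_ (PiLp.norm_apply_le _ i)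
  simp

lemma norm_le_one_of_posSemidef {X : Matrix n n ℂ} (h1 : (1 - X).PosSemidef)
    (h2 : (1 + X).PosSemidef) : ‖X‖ ≤ 1 := by
  have hX : X.IsHermitian := by
    have := h2.1.sub isHermitian_one
    rwa [add_sub_cancel_left] at this
  have h : (1 - Xᴴ * X).PosSemidef := by
    have h3 := h2.conjTranspose_mul_mul_same (1 - X)
    have h4 := h1.conjTranspose_mul_mul_same (1 + X)
    rw [h1.1.eq] at h3
    rw [h2.1.eq] at h4
    have h5 := (h3.add h4).smul (show (0 : ℝ) ≤ 1 / 2 by norm_num)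
    have e : (1 - X) * (1 + X) * (1 - X) + (1 + X) * (1 - X) * (1 + X) =
        (2 : ℝ) • (1 - X * X) := by
      rw [two_smul]; noncomm_ring
    rw [e, smul_smul] at h5
    rw [hX.eq]
    simpa using h5
  have hle : ‖Xᴴ * X‖ ≤ 1 :=
    (CStarAlgebra.norm_le_one_iff_of_nonneg _
      (posSemidef_conjTranspose_mul_self X).nonneg).2 (Matrix.le_iff.2 h)
  rw [l2_opNorm_conjTranspose_mul_self] at hle
  nlinarith [norm_nonneg X]

lemma norm_mul_mul_apply_le_one {A B C : Matrix n n ℂ} (hA : ‖A‖ ≤ 1) (hB : ‖B‖ ≤ 1)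
    (hC : ‖C‖ ≤ 1) (i j : n) : ‖(A * B * C) i j‖ ≤ 1 := by
  refine (norm_apply_le_l2_opNorm _ i j).trans ((norm_mul_le _ _).trans ?_)
  exact mul_le_one₀ ((norm_mul_le _ _).trans (mul_le_one₀ hA (norm_nonneg _) hB))
    (norm_nonneg _) hC

/-- If `±G ≤ exp L`, then `exp (-L / 2) * G * exp (-L / 2)` is a contraction. -/
lemma norm_conjExp_mul_mul_le_one {W G : Matrix n n ℂ} (hW : W * Wᴴ = 1) (hW' : Wᴴ * W = 1)
    (l : n → ℝ) (h1 : (conjExp W l 1 - G).PosSemidef) (h2 : (conjExp W l 1 + G).PosSemidef) :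
    ‖conjExp W l (-1 / 2) * G * conjExp W l (-1 / 2)‖ ≤ 1 := by
  have hadj : (conjExp W l (-1 / 2))ᴴ = conjExp W l (-1 / 2) := by
    rw [conjTranspose_conjExp]; simp
  have hone : conjExp W l (-1 / 2) * conjExp W l 1 * conjExp W l (-1 / 2) = 1 := by
    rw [← conjExp_add hW', ← conjExp_add hW', ← conjExp_zero hW l]; norm_num
  have k1 := h1.conjTranspose_mul_mul_same (conjExp W l (-1 / 2))
  have k2 := h2.conjTranspose_mul_mul_same (conjExp W l (-1 / 2))
  rw [hadj, Matrix.mul_sub, Matrix.sub_mul, hone] at k1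
  rw [hadj, Matrix.mul_add, Matrix.add_mul, hone] at k2
  exact norm_le_one_of_posSemidef k1 k2

/-- If `±diagonal g ≤ exp L`, then `Tr |g| log |g| ≤ Tr |g| L`. The proof applies the
Phragmén–Lindelöf principle to
`z ↦ Tr (exp (-z L / 2) * diagonal g * exp (-z L / 2) * diagonal (sign g * |g| ^ z))`. -/
lemma sum_abs_mul_log_le {W : Matrix n n ℂ} (hW : W * Wᴴ = 1) (l g : n → ℝ)
    (h1 : (conjExp W l 1 - diagonal (fun i => (g i : ℂ))).PosSemidef)
    (h2 : (conjExp W l 1 + diagonal (fun i => (g i : ℂ))).PosSemidef) :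
    ∑ i, |g i| * Real.log |g i| ≤
      ∑ i, |g i| * ((W * diagonal (fun a => (l a : ℂ)) * Wᴴ) i i).re := by
  have hW' : Wᴴ * W = 1 := mul_eq_one_comm.1 hW
  set G : Matrix n n ℂ := diagonal (fun i => (g i : ℂ)) with hG
  set s : n → ℝ := fun i => SignType.sign (g i) with hs
  have hsg : ∀ i, s i * g i = |g i| := fun i => by simp [hs]
  have hs1 : ∀ i, |s i| ≤ 1 := fun i => by
    rcases lt_trichotomy (g i) 0 with h | h | h <;> simp [hs, h]
  have hsa : ∀ i, |s i| * |g i| = |g i| := fun i => by rw [← abs_mul, hsg, abs_abs]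
  let R : ℂ → Matrix n n ℂ := fun z => conjExp W l (-z / 2)
  let N : ℂ → n → ℂ := fun z i => s i * Complex.exp (z * (Real.log |g i| : ℝ))
  let F : ℂ → ℂ := fun z => ∑ i, ∑ j, R z i j * g j * R z j i * N z i
  set c := ∑ i, |g i| with hc
  have hRd (z : ℂ) (i j : n) : HasDerivAt (fun z => R z i j)
      (∑ a, W i a * (Complex.exp (-z / 2 * l a) * (-1 / 2 * l a)) * star (W j a)) z := by
    simp only [R, conjExp_apply]
    refine HasDerivAt.fun_sum fun a _ => ?_
    refine ((HasDerivAt.cexp ?_).const_mul _).mul_const _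
    exact (((hasDerivAt_id z).neg.div_const 2).mul_const _)
  have hNd (z : ℂ) (i : n) : HasDerivAt (fun z => N z i)
      (s i * (Complex.exp (z * (Real.log |g i| : ℝ)) * (1 * (Real.log |g i| : ℝ)))) z :=
    (((hasDerivAt_id z).mul_const _).cexp).const_mul _
  have hFdiff : Differentiable ℂ F := by
    intro z
    refine DifferentiableAt.fun_sum fun i _ => DifferentiableAt.fun_sum fun j _ => ?_
    exact ((((hRd z i j).differentiableAt.mul_const _).mul (hRd z j i).differentiableAt).mul
      (hNd z i).differentiableAt)
  have hR0 : R 0 = 1 := by simp [R, conjExp_zero hW]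
  have hF0 : F 0 = c := by
    simp only [F, hR0, N, hc]
    push_cast
    refine Finset.sum_congr rfl fun i _ => ?_
    rw [Finset.sum_eq_single i (fun j _ hj => by simp [Matrix.one_apply, hj.symm]) (by simp)]
    simp only [one_apply_eq, zero_mul, Complex.exp_zero]
    rw [← hsg i]; push_cast; ring
  set L : Matrix n n ℂ := W * diagonal (fun a => (l a : ℂ)) * Wᴴ with hL
  have hLapp (i j : n) : L i j = ∑ a, W i a * l a * star (W j a) := by
    simp [hL, Matrix.mul_apply, Matrix.diagonal_apply]
  have hRd0 (i j : n) : HasDerivAt (fun z => R z i j) (-1 / 2 * L i j) 0 := by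
    convert hRd 0 i j using 1
    rw [hLapp, Finset.mul_sum]
    refine Finset.sum_congr rfl fun a _ => ?_
    simp; ring
  have hFd : HasDerivAt F (∑ i, |g i| * ((Real.log |g i| : ℝ) - L i i)) 0 := by
    have : HasDerivAt F (∑ i, ∑ j, (((-1 / 2 * L i j) * g j * R 0 j i +
        R 0 i j * g j * (-1 / 2 * L j i)) * N 0 i + R 0 i j * g j * R 0 j i *
        (s i * (Complex.exp (0 * (Real.log |g i| : ℝ)) * (1 * (Real.log |g i| : ℝ)))))) 0 := by
      refine HasDerivAt.fun_sum fun i _ => HasDerivAt.fun_sum fun j _ => ?_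
      exact (((hRd0 i j).mul_const _).mul (hRd0 j i)).mul (hNd 0 i)
    convert this using 1
    refine Finset.sum_congr rfl fun i _ => ?_
    rw [Finset.sum_eq_single i (fun j _ hj => by simp [hR0, hj, hj.symm])
      (by simp)]
    simp only [hR0, one_apply_eq, zero_mul, Complex.exp_zero, N]
    rw [← hsg i]; push_cast; ring
  have hFtr (z : ℂ) : F z = ∑ i, (R z * G * R z) i i * N z i := by
    simp only [F, Matrix.mul_apply, hG, Matrix.diagonal_apply]
    simp [Finset.sum_mul]
  have hFtr' (z : ℂ) : F z = ∑ j, (R z * diagonal (N z) * R z) j j * g j := by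
    simp only [F, Matrix.mul_apply, Matrix.diagonal_apply]
    rw [Finset.sum_comm]
    refine Finset.sum_congr rfl fun j _ => ?_
    simp only [mul_ite, mul_zero, Finset.sum_ite_eq', Finset.mem_univ, if_true, Finset.sum_mul]
    exact Finset.sum_congr rfl fun i _ => by ring
  have hNnorm (z : ℂ) (i : n) : ‖N z i‖ = |s i| * Real.exp (z.re * Real.log |g i|) := by
    simp [N, Complex.norm_exp]
  have hle0 (z : ℂ) (hz : z.re = 0) : ‖F z‖ ≤ c := by
    have hRz : ‖R z‖ ≤ 1 := norm_conjExp_le_one hW l (by simp [hz])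
    have hNz : ‖diagonal (N z)‖ ≤ 1 := by
      rw [l2_opNorm_diagonal]
      refine (pi_norm_le_iff_of_nonneg zero_le_one).2 fun i => ?_
      rw [hNnorm, hz]; simpa using hs1 i
    rw [hFtr']
    refine (norm_sum_le _ _).trans (Finset.sum_le_sum fun j _ => ?_)
    have := norm_mul_mul_apply_le_one hRz hNz hRz j j
    rw [norm_mul, Complex.norm_real, Real.norm_eq_abs]
    exact mul_le_of_le_one_left (abs_nonneg _) this
  have hX : ‖conjExp W l (-1 / 2) * G * conjExp W l (-1 / 2)‖ ≤ 1 :=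
    norm_conjExp_mul_mul_le_one hW hW' l h1 h2
  have hle1 (z : ℂ) (hz : z.re = 1) : ‖F z‖ ≤ c := by
    rw [hFtr]
    refine (norm_sum_le _ _).trans (Finset.sum_le_sum fun i _ => ?_)
    set w : ℂ := -(z - 1) / 2
    have hRw : ‖conjExp W l w‖ ≤ 1 := norm_conjExp_le_one hW l (by simp [w, hz])
    have e3 : R z * G * R z = conjExp W l w * (conjExp W l (-1 / 2) * G * conjExp W l (-1 / 2)) *
        conjExp W l w := by
      have e1 : conjExp W l (w + -1 / 2) = R z := by congr 1; simp only [w]; ring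
      have e2 : conjExp W l (-1 / 2 + w) = R z := by rw [add_comm, e1]
      rw [conjExp_add hW'] at e1 e2
      simp only [← Matrix.mul_assoc, e1]
      rw [Matrix.mul_assoc _ _ (conjExp W l w), e2]
    have : ‖(R z * G * R z) i i‖ ≤ 1 := by
      rw [e3]
      exact norm_mul_mul_apply_le_one hRw hX hRw i i
    have hN : ‖N z i‖ = |g i| := by
      rw [hNnorm, hz, one_mul]
      by_cases hgi : g i = 0
      · simp [hs, hgi]
      · rw [Real.exp_log (abs_pos.2 hgi), hsa]
    rw [norm_mul, hN]
    exact mul_le_of_le_one_left (abs_nonneg _) this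
  have hbdd : ∃ C, ∀ z : ℂ, z.re ∈ Set.Ioo (0 : ℝ) 1 → ‖F z‖ ≤ C := by
    have hexp (t : ℝ) (ht : t ∈ Set.Ioo (0 : ℝ) 1) (x : ℝ) : Real.exp (t * x) ≤ Real.exp |x| :=
      Real.exp_le_exp.2 (by nlinarith [le_abs_self x, abs_nonneg x, ht.1, ht.2])
    have hRb (z : ℂ) (hz : z.re ∈ Set.Ioo (0 : ℝ) 1) (i j : n) :
        ‖R z i j‖ ≤ ∑ a, ‖W i a‖ * Real.exp |(-1 / 2 * l a)| * ‖W j a‖ := by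
      simp only [R, conjExp_apply]
      refine (norm_sum_le _ _).trans (Finset.sum_le_sum fun a _ => ?_)
      rw [norm_mul, norm_mul, norm_star, Complex.norm_exp]
      have hre : (-z / 2 * l a).re = z.re * (-1 / 2 * l a) := by simp; ring
      rw [hre]
      have := hexp _ hz (-1 / 2 * l a)
      gcongr ?_ * ?_ * _
    refine ⟨∑ i, ∑ j, (∑ a, ‖W i a‖ * Real.exp |(-1 / 2 * l a)| * ‖W j a‖) * |g j| *
      (∑ a, ‖W j a‖ * Real.exp |(-1 / 2 * l a)| * ‖W i a‖) *
      (|s i| * Real.exp |Real.log (|g i|)|), fun z hz => ?_⟩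
    refine (norm_sum_le _ _).trans (Finset.sum_le_sum fun i _ => ?_)
    refine (norm_sum_le _ _).trans (Finset.sum_le_sum fun j _ => ?_)
    rw [norm_mul, norm_mul, norm_mul, hNnorm, Complex.norm_real, Real.norm_eq_abs]
    have := hRb z hz i j
    have := hRb z hz j i
    have := hexp _ hz (Real.log |g i|)
    gcongr
  have hstrip (t : ℝ) (h0 : 0 ≤ t) (h1 : t ≤ 1) : ‖F t‖ ≤ c := by
    refine PhragmenLindelof.vertical_strip (a := 0) (b := 1) hFdiff.diffContOnCl ?_ hle0 hle1
      (by simpa) (by simpa)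
    obtain ⟨C, hC⟩ := hbdd
    refine ⟨0, by simpa using Real.pi_pos, 0, ?_⟩
    refine Asymptotics.IsBigO.of_bound C ?_
    refine Filter.mem_inf_of_right (Filter.mem_principal.2 fun z hz => ?_)
    simpa using hC z hz
  have hreal : HasDerivAt (fun t : ℝ => (F t).re)
      (∑ i, |g i| * (Real.log |g i| - (L i i).re)) 0 := by
    have := (show HasDerivAt F _ ((0 : ℝ) : ℂ) by simpa using hFd).real_of_complex
    convert this using 1
    simp
  have hnonpos : ∑ i, |g i| * (Real.log |g i| - (L i i).re) ≤ 0 := by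
    refine le_of_tendsto hreal.tendsto_slope_zero_right ?_
    filter_upwards [Ioo_mem_nhdsGT (zero_lt_one (α := ℝ))] with t ht
    have h3 : (F t).re ≤ c := (Complex.re_le_norm _).trans (hstrip t ht.1.le ht.2.le)
    have h4 : (F ((0 : ℝ) : ℂ)).re = c := by simp [hF0]
    simp only [zero_add, smul_eq_mul]
    rw [h4]
    exact mul_nonpos_of_nonneg_of_nonpos (inv_nonneg.2 ht.1.le) (by linarith)
  simp only [mul_sub, Finset.sum_sub_distrib] at hnonpos
  linarith

/-- The functional calculus `mfun` can be computed in any unitary diagonalization. -/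
lemma mfun_conj_diagonal {V : Matrix n n ℂ} (hV : V * Vᴴ = 1) (f : ℝ → ℝ) (d : n → ℝ) :
    mfun f (V * diagonal (fun i => (d i : ℂ)) * Vᴴ) =
      V * diagonal (fun i => (f (d i) : ℂ)) * Vᴴ := by
  set A := V * diagonal (fun i => (d i : ℂ)) * Vᴴ with hA
  have hV' : Vᴴ * V = 1 := mul_eq_one_comm.1 hV
  have hAh : A.IsHermitian := by
    refine isHermitian_mul_mul_conjTranspose V (isHermitian_diagonal_of_self_adjoint _ ?_)
    ext i
    simp
  rw [mfun, dif_pos hAh]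
  set E : Matrix n n ℂ := (hAh.eigenvectorUnitary : Matrix n n ℂ)
  set μ := hAh.eigenvalues
  have hE : E * Eᴴ = 1 := Unitary.mul_star_self_of_mem hAh.eigenvectorUnitary.2
  have hE' : Eᴴ * E = 1 := mul_eq_one_comm.1 hE
  have hspec : A = E * diagonal (fun i => (μ i : ℂ)) * Eᴴ := hAh.spectral_theorem
  have hcomm : diagonal (fun i => (μ i : ℂ)) * (Eᴴ * V) =
      (Eᴴ * V) * diagonal (fun i => (d i : ℂ)) := by
    calc diagonal (fun i => (μ i : ℂ)) * (Eᴴ * V)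
        = (Eᴴ * E) * diagonal (fun i => (μ i : ℂ)) * Eᴴ * V := by
          rw [hE', Matrix.one_mul, Matrix.mul_assoc]
      _ = Eᴴ * A * V := by rw [hspec]; simp only [Matrix.mul_assoc]
      _ = (Eᴴ * V) * diagonal (fun i => (d i : ℂ)) * (Vᴴ * V) := by
          rw [hA]; simp only [Matrix.mul_assoc]
      _ = _ := by rw [hV', Matrix.mul_one]
  have hcommf : diagonal (fun i => (f (μ i) : ℂ)) * (Eᴴ * V) =
      (Eᴴ * V) * diagonal (fun i => (f (d i) : ℂ)) := by
    ext i j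
    have h := congrFun (congrFun hcomm i) j
    rw [diagonal_mul, mul_diagonal, mul_comm] at h
    rw [diagonal_mul, mul_diagonal, mul_comm]
    by_cases h0 : (Eᴴ * V) i j = 0
    · simp [h0]
    · rw [Complex.ofReal_injective (mul_left_cancel₀ h0 h)]
  calc E * diagonal (fun i => (f (μ i) : ℂ)) * star E
      = E * (diagonal (fun i => (f (μ i) : ℂ)) * (Eᴴ * V)) * Vᴴ := by
        simp only [Matrix.mul_assoc, hV, Matrix.mul_one, star_eq_conjTranspose]
    _ = (E * Eᴴ) * V * diagonal (fun i => (f (d i) : ℂ)) * Vᴴ := by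
        rw [hcommf]; simp only [Matrix.mul_assoc]
    _ = _ := by rw [hE, Matrix.one_mul]

lemma mlog_conj_diagonal {V : Matrix n n ℂ} (hV : V * Vᴴ = 1) (d : n → ℝ) :
    mlog (V * diagonal (fun i => (d i : ℂ)) * Vᴴ) =
      V * diagonal (fun i => (Real.log (d i) : ℂ)) * Vᴴ := by
  rw [mlog, mfun_conj_diagonal hV]
  congr 3
  ext i
  split_ifs with h <;> simp [h]

lemma trace_conj_diagonal_mul (V M : Matrix n n ℂ) (a : n → ℝ) :
    ((V * diagonal (fun i => (a i : ℂ)) * Vᴴ * M).trace).re =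
      ∑ i, a i * ((Vᴴ * M * V) i i).re := by
  rw [Matrix.mul_assoc, Matrix.mul_assoc, trace_mul_comm, Matrix.mul_assoc, trace,
    Complex.re_sum]
  simp [diagonal_mul]

lemma exists_conj_diagonal {A : Matrix n n ℂ} (hA : A.IsHermitian) :
    ∃ (V : Matrix n n ℂ) (d : n → ℝ), V * Vᴴ = 1 ∧
      A = V * diagonal (fun i => (d i : ℂ)) * Vᴴ :=
  ⟨hA.eigenvectorUnitary, hA.eigenvalues,
    Unitary.mul_star_self_of_mem hA.eigenvectorUnitary.2, hA.spectral_theorem⟩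

/-- If `±γ ≤ σ`, then `Tr |γ| log |γ| ≤ Tr |γ| log σ`. -/
lemma sum_abs_mul_log_le_trace {V σ : Matrix n n ℂ} (hV : V * Vᴴ = 1) (g : n → ℝ)
    (hσ : σ.PosSemidef)
    (h1 : (σ - V * diagonal (fun i => (g i : ℂ)) * Vᴴ).PosSemidef)
    (h2 : (σ + V * diagonal (fun i => (g i : ℂ)) * Vᴴ).PosSemidef) :
    ∑ i, |g i| * Real.log |g i| ≤
      ((V * diagonal (fun i => ((|g i| : ℝ) : ℂ)) * Vᴴ * mlog σ).trace).re := by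
  have hV' : Vᴴ * V = 1 := mul_eq_one_comm.1 hV
  obtain ⟨Q, d, hQ, rfl⟩ := exists_conj_diagonal hσ.1
  have hd (i : n) : 0 ≤ d i := by
    have h := hσ.conjTranspose_mul_mul_same Q
    have e : Qᴴ * (Q * diagonal (fun i => (d i : ℂ)) * Qᴴ) * Q =
        (Qᴴ * Q) * diagonal (fun i => (d i : ℂ)) * (Qᴴ * Q) := by
      simp only [Matrix.mul_assoc]
    rw [e, mul_eq_one_comm.1 hQ, Matrix.one_mul, Matrix.mul_one, posSemidef_diagonal_iff] at h
    exact_mod_cast h i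
  set l : n → ℝ := fun i => Real.log (d i)
  have hdl (i : n) : d i ≤ Real.exp (l i) := by
    rcases (hd i).eq_or_lt with h | h
    · rw [← h]; positivity
    · exact (Real.exp_log h).ge
  have hgap : (conjExp Q l 1 - Q * diagonal (fun i => (d i : ℂ)) * Qᴴ).PosSemidef := by
    have h : (diagonal (fun i => ((Real.exp (l i) - d i : ℝ) : ℂ))).PosSemidef :=
      PosSemidef.diagonal fun i => by
        simpa only [Pi.zero_apply, Complex.zero_le_real, sub_nonneg] using hdl i
    convert h.mul_mul_conjTranspose_same Q using 1
    rw [conjExp, ← Matrix.sub_mul, ← Matrix.mul_sub, diagonal_sub]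
    simp
  have hW : (Vᴴ * Q) * (Vᴴ * Q)ᴴ = 1 := by
    rw [conjTranspose_mul, conjTranspose_conjTranspose, Matrix.mul_assoc, ← Matrix.mul_assoc Q,
      hQ, Matrix.one_mul, hV']
  have hexp : conjExp (Vᴴ * Q) l 1 = Vᴴ * conjExp Q l 1 * V := by
    simp only [conjExp, conjTranspose_mul, conjTranspose_conjTranspose, Matrix.mul_assoc]
  have hdiag : diagonal (fun i => (g i : ℂ)) =
      Vᴴ * (V * diagonal (fun i => (g i : ℂ)) * Vᴴ) * V := by
    have e : Vᴴ * (V * diagonal (fun i => (g i : ℂ)) * Vᴴ) * V =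
        (Vᴴ * V) * diagonal (fun i => (g i : ℂ)) * (Vᴴ * V) := by
      simp only [Matrix.mul_assoc]
    rw [e, hV', Matrix.one_mul, Matrix.mul_one]
  have key := sum_abs_mul_log_le hW l g
    (by
      rw [hexp, hdiag, ← Matrix.sub_mul, ← Matrix.mul_sub]
      convert (hgap.add h1).conjTranspose_mul_mul_same V using 3
      abel)
    (by
      rw [hexp, hdiag, ← Matrix.add_mul, ← Matrix.mul_add]
      convert (hgap.add h2).conjTranspose_mul_mul_same V using 3
      abel)
  rw [mlog_conj_diagonal hQ, trace_conj_diagonal_mul]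
  simpa only [conjTranspose_mul, conjTranspose_conjTranspose, Matrix.mul_assoc] using key

lemma mulVec_eq_zero_of_posSemidef_sub_add {m : Type*} [Fintype m] {σ γ : Matrix m m ℂ}
    (h1 : (σ - γ).PosSemidef)
    (h2 : (σ + γ).PosSemidef) {v : m → ℂ} (hv : σ *ᵥ v = 0) : γ *ᵥ v = 0 := by
  have k1 := h1.dotProduct_mulVec_nonneg v
  have k2 := h2.dotProduct_mulVec_nonneg v
  rw [sub_mulVec, hv, zero_sub, dotProduct_neg, neg_nonneg] at k1
  rw [add_mulVec, hv, zero_add] at k2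
  have h := (h2.dotProduct_mulVec_zero_iff v).1
    (by rw [add_mulVec, hv, zero_add]; exact le_antisymm k1 k2)
  rwa [add_mulVec, hv, zero_add] at h

lemma isState_conj_diagonal {V : Matrix n n ℂ} (hV : V * Vᴴ = 1) {p : n → ℝ}
    (hp : ∀ i, 0 ≤ p i) (hp1 : ∑ i, p i = 1) :
    IsState (V * diagonal (fun i => (p i : ℂ)) * Vᴴ) := by
  constructor
  · refine (PosSemidef.diagonal fun i => ?_).mul_mul_conjTranspose_same V
    simpa using hp i
  · rw [trace_mul_comm, ← Matrix.mul_assoc, mul_eq_one_comm.1 hV, Matrix.one_mul, trace_diagonal]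
    exact_mod_cast hp1

/-- If `±γ ≤ σ`, then the state `|γ| / Tr |γ|` is at relative entropy at most `-log Tr |γ|`
from `σ`. -/
lemma umegaki_conj_diagonal_abs_le {V σ : Matrix n n ℂ} (hV : V * Vᴴ = 1) (g : n → ℝ)
    (hσ : σ.PosSemidef) (hc : 0 < ∑ i, |g i|)
    (h1 : (σ - V * diagonal (fun i => (g i : ℂ)) * Vᴴ).PosSemidef)
    (h2 : (σ + V * diagonal (fun i => (g i : ℂ)) * Vᴴ).PosSemidef) :
    suppLE (V * diagonal (fun i => ((|g i| / ∑ j, |g j| : ℝ) : ℂ)) * Vᴴ) σ ∧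
      umegakiR (V * diagonal (fun i => ((|g i| / ∑ j, |g j| : ℝ) : ℂ)) * Vᴴ) σ ≤
        -Real.log (∑ i, |g i|) := by
  have hV' : Vᴴ * V = 1 := mul_eq_one_comm.1 hV
  set c := ∑ i, |g i| with hcdef
  constructor
  · intro v hv
    have h := mulVec_eq_zero_of_posSemidef_sub_add h1 h2 hv
    have e : V * diagonal (fun i => ((|g i| / c : ℝ) : ℂ)) * Vᴴ =
        (V * diagonal (fun i => (((SignType.sign (g i) : ℝ) / c : ℝ) : ℂ)) * Vᴴ) *
          (V * diagonal (fun i => (g i : ℂ)) * Vᴴ) := by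
      have e2 : (V * diagonal (fun i => (((SignType.sign (g i) : ℝ) / c : ℝ) : ℂ)) * Vᴴ) *
          (V * diagonal (fun i => (g i : ℂ)) * Vᴴ) =
          V * (diagonal (fun i => (((SignType.sign (g i) : ℝ) / c : ℝ) : ℂ)) * ((Vᴴ * V) *
            diagonal (fun i => (g i : ℂ)))) * Vᴴ := by
        simp only [Matrix.mul_assoc]
      rw [e2, hV', Matrix.one_mul, diagonal_mul_diagonal]
      congr 3
      ext i
      rw [← sign_mul_self (g i)]
      push_cast
      ring
    rw [e, ← mulVec_mulVec, h, mulVec_zero]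
  · have key := sum_abs_mul_log_le_trace hV g hσ h1 h2
    rw [umegakiR, Matrix.mul_sub, trace_sub, Complex.sub_re, mlog_conj_diagonal hV,
      trace_conj_diagonal_mul, trace_conj_diagonal_mul]
    rw [trace_conj_diagonal_mul] at key
    have e : Vᴴ * (V * diagonal (fun i => (Real.log (|g i| / c) : ℂ)) * Vᴴ) * V =
        diagonal (fun i => (Real.log (|g i| / c) : ℂ)) := by
      have e2 : Vᴴ * (V * diagonal (fun i => (Real.log (|g i| / c) : ℂ)) * Vᴴ) * V =
          (Vᴴ * V) * diagonal (fun i => (Real.log (|g i| / c) : ℂ)) * (Vᴴ * V) := by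
        simp only [Matrix.mul_assoc]
      rw [e2, hV', Matrix.one_mul, Matrix.mul_one]
    have hlog : ∑ i, |g i| / c * ((diagonal (fun i => (Real.log (|g i| / c) : ℂ)) :
        Matrix n n ℂ) i i).re = (∑ i, |g i| * Real.log |g i|) / c - Real.log c := by
      have hs : ∑ i, |g i| / c = 1 := by
        rw [← Finset.sum_div, ← hcdef, div_self hc.ne']
      rw [← one_mul (Real.log c), ← hs, Finset.sum_mul, Finset.sum_div,
        ← Finset.sum_sub_distrib]
      refine Finset.sum_congr rfl fun i _ => ?_
      rw [diagonal_apply_eq, Complex.ofReal_re]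
      by_cases hgi : g i = 0
      · simp [hgi]
      · rw [Real.log_div (abs_pos.2 hgi).ne' hc.ne']; ring
    have hdiv : ∑ i, |g i| / c * ((Vᴴ * mlog σ * V) i i).re =
        (∑ i, |g i| * ((Vᴴ * mlog σ * V) i i).re) / c := by
      rw [Finset.sum_div]
      exact Finset.sum_congr rfl fun i _ => by ring
    rw [e, hlog, hdiv]
    have := div_le_div_of_nonneg_right key hc.le
    linarith

lemma coe_finset_sum {ι : Type*} (t : Finset ι) (f : ι → ℝ) :
    ((∑ x ∈ t, f x : ℝ) : EReal) = ∑ x ∈ t, (f x : EReal) :=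
  map_sum (⟨⟨Real.toEReal, EReal.coe_zero⟩, EReal.coe_add⟩ : ℝ →+ EReal) f t

end LogEntropy

/-- the multivariate log-Euclidean Chernoff divergence is upper
bounded by `−ln κ(ρ_{[r]})`. -/
theorem log_euclidean_chernoff_le_neg_log_kappa
    {n ι : Type} [Fintype n] [DecidableEq n] [Fintype ι] [Nonempty ι]
    (ρ : ι → Matrix n n ℂ) (hρ : ∀ x, IsState (ρ x)) :
    (⨆ s ∈ probSimplex ι, ⨅ τ ∈ {τ : Matrix n n ℂ | IsState τ},
        ∑ x, ((s x : ℝ) : EReal) * umegaki τ (ρ x)) ≤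
      negLogE (sSup {t : ℝ | ∃ γ : Matrix n n ℂ, γ.IsHermitian ∧
        (∀ x, (ρ x - γ).PosSemidef ∧ (ρ x + γ).PosSemidef) ∧ t = (γ.trace).re}) := by
  have bound (s : ι → ℝ) (hs : s ∈ probSimplex ι) (γ : Matrix n n ℂ) (hγ : γ.IsHermitian)
      (h : ∀ x, (ρ x - γ).PosSemidef ∧ (ρ x + γ).PosSemidef) (ht : 0 < (γ.trace).re) :
      (⨅ τ ∈ {τ : Matrix n n ℂ | IsState τ}, ∑ x, ((s x : ℝ) : EReal) * umegaki τ (ρ x)) ≤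
        ((-Real.log (γ.trace).re : ℝ) : EReal) := by
    obtain ⟨V, g, hV, rfl⟩ := exists_conj_diagonal hγ
    have htr : ((V * diagonal (fun i => (g i : ℂ)) * Vᴴ).trace).re = ∑ i, g i := by
      rw [trace_mul_comm, ← Matrix.mul_assoc, mul_eq_one_comm.1 hV, Matrix.one_mul,
        trace_diagonal]
      simp
    rw [htr] at ht ⊢
    have hgc : ∑ i, g i ≤ ∑ i, |g i| := Finset.sum_le_sum fun i _ => le_abs_self _
    have hc := ht.trans_le hgc
    refine iInf₂_le_of_le (V * diagonal (fun i => ((|g i| / ∑ j, |g j| : ℝ) : ℂ)) * Vᴴ)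
      (isState_conj_diagonal hV (fun i => by positivity)
        (by rw [← Finset.sum_div, div_self hc.ne'])) ?_
    have hx (x : ι) := umegaki_conj_diagonal_abs_le hV g (hρ x).1 hc (h x).1 (h x).2
    simp only [umegaki, if_pos (hx _).1, ← EReal.coe_mul]
    rw [← coe_finset_sum, EReal.coe_le_coe_iff]
    calc ∑ x, s x * umegakiR _ (ρ x) ≤ ∑ x, s x * -Real.log (∑ i, |g i|) :=
          Finset.sum_le_sum fun x _ => mul_le_mul_of_nonneg_left (hx x).2 (hs.1 x)
      _ = -Real.log (∑ i, |g i|) := by rw [← Finset.sum_mul, hs.2, one_mul]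
      _ ≤ _ := neg_le_neg (Real.log_le_log ht hgc)
  rw [negLogE]
  split_ifs with hκ
  · exact le_top
  push Not at hκ
  refine iSup₂_le fun s hs => le_of_not_gt fun hlt => ?_
  obtain ⟨y, hy1, hy2⟩ := EReal.lt_iff_exists_real_btwn.1 hlt
  rw [EReal.coe_lt_coe_iff, neg_lt, Real.lt_log_iff_exp_lt hκ] at hy1
  obtain ⟨_, ⟨γ, hγ, h, rfl⟩, ht⟩ := exists_lt_of_lt_csSup
    (by exact ⟨0, 0, isHermitian_zero, fun x => by simpa using (hρ x).1, by simp⟩) hy1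
  have ht0 := (Real.exp_pos _).trans ht
  have := hy2.trans_le (bound s hs γ hγ h ht0)
  rw [EReal.coe_lt_coe_iff, lt_neg, Real.log_lt_iff_lt_exp ht0] at this
  exact lt_asymm ht this

end QHE
end
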